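/- arXiv:2107.12115 — 2 statements merged into one kernel-verified Lean document; each statement's English description precedes it below -/
import Mathlib

section
/- Let α ∈ (0,1) and u ∈ B^α_{1,∞}(𝕋). If u is mixing on the scale H^{1/2}(𝕋;ℂ) with rate r, then there exists a constant C = C(α,u) > 0 such that r(t) ≤ C t^{1/(2α)} for all t ≥ 1. -/
open MeasureTheory Real Set
open scoped ENNReal NNReal

noncomputable section


/-- The Besov--Nikolskii seminorm `⟦u⟧_{B^α_{1,∞}(𝕋)}` of a `2π`-periodic function,
`sup_{0<h≤π} h^{−α} ∫_{−π}^{π} |u(y+h) − u(y)| dy` (valued in `ℝ≥0∞`). -/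
def besovSeminorm (α : ℝ) (u : ℝ → ℝ) : ℝ≥0∞ :=
  ⨆ h ∈ Set.Ioc (0:ℝ) π,
    ENNReal.ofReal (h ^ (-α)) * ∫⁻ y in Set.Ioc (-π) π, ENNReal.ofReal |u (y + h) - u y|

/-- The Besov--Nikolskii norm `‖u‖_{B^α_{1,∞}(𝕋)}`. -/
def besovNorm (α : ℝ) (u : ℝ → ℝ) : ℝ≥0∞ :=
  (∫⁻ y in Set.Ioc (-π) π, ENNReal.ofReal |u y|) + besovSeminorm α u


/-- The `n`-th Fourier coefficient of a `2π`-periodic function `g : 𝕋 → ℂ`. -/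
def fourierCoefT (g : ℝ → ℂ) (n : ℤ) : ℂ :=
  (1 / (2 * π) : ℂ) * ∫ y in (-π)..π, g y * Complex.exp (-(Complex.I * n * y))

/-- The Sobolev norm `‖g‖_{H^s(𝕋;ℂ)} = (Σ_n (1+n²)^s |ĝ(n)|²)^{1/2}` (valued in `ℝ≥0∞`). -/
def sobolevNorm (s : ℝ) (g : ℝ → ℂ) : ℝ≥0∞ :=
  (∑' n : ℤ, ENNReal.ofReal ((1 + (n : ℝ) ^ 2) ^ s) * (‖fourierCoefT g n‖₊ : ℝ≥0∞) ^ 2)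
    ^ (1 / 2 : ℝ)

/-- The `(k,n)`-th Fourier coefficient of a function `f : 𝕋² → ℝ`. -/
def fourierCoefT2 (f : ℝ → ℝ → ℝ) (k n : ℤ) : ℂ :=
  (1 / (2 * π) ^ 2 : ℂ) * ∫ x in (-π)..π, ∫ y in (-π)..π,
    (f x y : ℂ) * Complex.exp (-(Complex.I * ((k : ℂ) * x + (n : ℂ) * y)))

/-- The Sobolev norm `‖f‖_{H^s(𝕋²)}` (valued in `ℝ≥0∞`). -/
def sobolevNorm2 (s : ℝ) (f : ℝ → ℝ → ℝ) : ℝ≥0∞ :=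
  (∑' p : ℤ × ℤ, ENNReal.ofReal ((1 + (p.1 : ℝ) ^ 2 + (p.2 : ℝ) ^ 2) ^ s) *
    (‖fourierCoefT2 f p.1 p.2‖₊ : ℝ≥0∞) ^ 2) ^ (1 / 2 : ℝ)

/-- `u` satisfies the `(γ,ρ)`-irregularity estimate with constant `C`:
`|∫_s^t e^{iξu(z)} dz| ≤ C (t−s)^γ |ξ|^{−ρ}` for all `s < t` and `ξ ≠ 0`. -/
def IrregOn (γ ρ : ℝ) (u : ℝ → ℝ) (C : ℝ) : Prop :=
  ∀ s t : ℝ, s < t → ∀ ξ : ℝ, ξ ≠ 0 →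
    ‖∫ z in s..t, Complex.exp (Complex.I * ξ * u z)‖ ≤ C * (t - s) ^ γ * |ξ| ^ (-ρ)

/-- `‖Φ^u‖_{γ,ρ}`, the optimal constant in the `(γ,ρ)`-irregularity estimate. -/
def phiNorm (γ ρ : ℝ) (u : ℝ → ℝ) : ℝ := sInf {C : ℝ | 0 ≤ C ∧ IrregOn γ ρ u C}

/-- `u` is mixing on the scale `H^{1/2}(𝕋;ℂ)` with rate `r`. -/
def MixingHalf (u : ℝ → ℝ) (r : ℝ → ℝ) : Prop :=
  ∃ C > (0:ℝ), ∀ k : ℤ, k ≠ 0 → ∀ t : ℝ, 1 ≤ t → ∀ g : ℝ → ℂ,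
    Measurable g → Function.Periodic g (2 * π) → sobolevNorm (1/2) g < ⊤ →
    sobolevNorm (-(1/2)) (fun y => Complex.exp (-(Complex.I * t * k * u y)) * g y)
      ≤ (ENNReal.ofReal C / ENNReal.ofReal (r (t * |(k : ℝ)|))) * sobolevNorm (1/2) g

lemma fourierCoefT_eq_fourierCoeffOn (g : ℝ → ℂ) (n : ℤ) :
    fourierCoefT g n = fourierCoeffOn (neg_lt_self pi_pos) g n := by
  rw [fourierCoeffOn_eq_integral, fourierCoefT, Complex.real_smul]
  congr 1
  · push_cast; ring
  · refine intervalIntegral.integral_congr fun y _ => ?_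
    simp only [fourier_coe_apply, smul_eq_mul]
    rw [mul_comm]
    congr 2
    have : (π : ℂ) ≠ 0 := by exact_mod_cast pi_ne_zero
    push_cast
    field_simp
    ring

lemma hasSum_sq_fourierCoefT {g : ℝ → ℂ} (hg : Measurable g) {B : ℝ} (hB : ∀ y, ‖g y‖ ≤ B) :
    HasSum (fun n : ℤ => ‖fourierCoefT g n‖ ^ 2) ((2 * π)⁻¹ * ∫ y in (-π)..π, ‖g y‖ ^ 2) := by
  have h := hasSum_sq_fourierCoeffOn (neg_lt_self pi_pos)
    (MemLp.of_bound (p := 2) (μ := volume.restrict (Ioc (-π) π)) hg.aestronglyMeasurable B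
      (ae_of_all _ hB))
  simp only [fourierCoefT_eq_fourierCoeffOn]
  convert h using 1
  rw [smul_eq_mul, sub_neg_eq_add, two_mul]

lemma fourierCoefT_add_sub {g : ℝ → ℂ} (hg : Measurable g) {B : ℝ} (hB : ∀ y, ‖g y‖ ≤ B)
    (hper : Function.Periodic g (2 * π)) (h : ℝ) (n : ℤ) :
    fourierCoefT (fun y => g (y + h) - g y) n
      = (Complex.exp (Complex.I * (n * h : ℝ)) - 1) * fourierCoefT g n := by
  set e : ℝ → ℂ := fun y => Complex.exp (-(Complex.I * n * y)) with he
  have hem : Measurable e := by fun_prop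
  have hen : ∀ y, ‖e y‖ = 1 := fun y => by
    have := Complex.norm_exp_I_mul_ofReal (-(n * y))
    rw [he, ← this]; push_cast; ring_nf
  have hint : ∀ c : ℝ, IntervalIntegrable (fun y => g (y + c) * e y) volume (-π) π := by
    intro c
    rw [intervalIntegrable_iff, uIoc_of_le (neg_lt_self pi_pos).le]
    refine Integrable.of_bound (C := B) ?_ (ae_of_all _ fun y => ?_)
    · exact ((hg.comp (measurable_id.add_const c)).mul hem).aestronglyMeasurable
    · rw [norm_mul, hen, mul_one]; exact hB _
  have hint0 : IntervalIntegrable (fun y => g y * e y) volume (-π) π := by simpa using hint 0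
  have hpe : Function.Periodic (fun y => g y * e y) (2 * π) := by
    intro y
    have h1 : e (y + 2 * π) = e y := by
      simp only [he]
      rw [Complex.exp_eq_exp_iff_exists_int]
      exact ⟨-n, by push_cast; ring⟩
    simp only [hper y, h1]
  have hshift : ∫ y in (-π)..π, g (y + h) * e y
      = Complex.exp (Complex.I * (n * h : ℝ)) * ∫ y in (-π)..π, g y * e y := by
    have h1 : ∀ y, g (y + h) * e y
        = Complex.exp (Complex.I * (n * h : ℝ)) * (g (y + h) * e (y + h)) := fun y => by
      have : e y = Complex.exp (Complex.I * (n * h : ℝ)) * e (y + h) := by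
        simp only [he]
        rw [← Complex.exp_add]; congr 1; push_cast; ring
      rw [this]; ring
    simp_rw [h1]
    rw [intervalIntegral.integral_const_mul,
      intervalIntegral.integral_comp_add_right (fun y => g y * e y)]
    congr 1
    have := hpe.intervalIntegral_add_eq (-π + h) (-π)
    convert this using 2 <;> ring
  unfold fourierCoefT
  simp_rw [sub_mul]
  rw [intervalIntegral.integral_sub (hint h) hint0, hshift]
  ring

lemma sq_norm_exp_I_mul_sub_one (x : ℝ) :
    ‖Complex.exp (Complex.I * x) - 1‖ ^ 2 = 2 - 2 * Real.cos x := by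
  rw [Complex.norm_exp_I_mul_ofReal_sub_one, Real.norm_eq_abs, sq_abs, mul_pow,
    Real.sin_sq_eq_half_sub]
  ring_nf

lemma hasSum_sq_fourierCoefT_mul_cos {g : ℝ → ℂ} (hg : Measurable g) (h1 : ∀ y, ‖g y‖ = 1)
    (hper : Function.Periodic g (2 * π)) (h : ℝ) :
    HasSum (fun n : ℤ => ‖fourierCoefT g n‖ ^ 2 * Real.cos (n * h))
      (1 - (2 * π)⁻¹ * (∫ y in (-π)..π, ‖g (y + h) - g y‖ ^ 2) / 2) := by
  have hs := hasSum_sq_fourierCoefT hg (fun y => (h1 y).le)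
  have hd := hasSum_sq_fourierCoefT (g := fun y => g (y + h) - g y) (B := 2)
    ((hg.comp (measurable_id.add_const h)).sub hg)
    (fun y => (norm_sub_le _ _).trans (by rw [h1, h1]; norm_num))
  simp only [h1, fourierCoefT_add_sub hg (fun y => (h1 y).le) hper, norm_mul, mul_pow,
    sq_norm_exp_I_mul_sub_one] at hs hd
  have hone : (2 * π)⁻¹ * ∫ _ in (-π)..π, (1 : ℝ) ^ 2 = 1 := by
    simp only [one_pow, intervalIntegral.integral_const, smul_eq_mul]
    field_simp
    norm_num
  rw [hone] at hs
  have hterm : ∀ n : ℤ, ‖fourierCoefT g n‖ ^ 2 * Real.cos (n * h) = ‖fourierCoefT g n‖ ^ 2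
      - (2 - 2 * Real.cos (n * h)) * ‖fourierCoefT g n‖ ^ 2 / 2 := fun n => by ring
  simp only [hterm]
  exact hs.sub (hd.div_const 2)

lemma integral_cos_int_mul_le {H : ℝ} (hH1 : H ≤ 1) (n : ℤ) :
    ∫ h in (0:ℝ)..H, Real.cos (n * h) ≤ 2 * (1 + (n : ℝ) ^ 2) ^ (-(1 / 2) : ℝ) := by
  rcases eq_or_ne n 0 with rfl | hn
  · simp; linarith
  have hn' : (n : ℝ) ≠ 0 := by exact_mod_cast hn
  have hn1 : 1 ≤ |(n : ℝ)| := by exact_mod_cast Int.one_le_abs hn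
  rw [intervalIntegral.integral_comp_mul_left _ hn', integral_cos]
  have hp : 0 < 1 + (n : ℝ) ^ 2 := by positivity
  rw [rpow_neg hp.le, ← Real.sqrt_eq_rpow]
  have h1 : Real.sqrt (1 + (n : ℝ) ^ 2) ≤ 2 * |(n : ℝ)| := by
    rw [Real.sqrt_le_left (by positivity), mul_pow, sq_abs]
    nlinarith [sq_abs (n : ℝ)]
  calc _ ≤ |(n : ℝ)|⁻¹ := by
        refine (le_abs_self _).trans ?_
        rw [smul_eq_mul, abs_mul, abs_inv]
        refine mul_le_of_le_one_right (by positivity) ?_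
        simpa using Real.abs_sin_le_one _
    _ = 2 * (2 * |(n : ℝ)|)⁻¹ := by field_simp
    _ ≤ _ := by gcongr

/-- A lower bound on the `H^{-1/2}` mass of a unimodular function which is nearly invariant under
translations of length at most `H`. -/
lemma le_tsum_sq_fourierCoefT_mul_rpow {g : ℝ → ℂ} (hg : Measurable g) (h1 : ∀ y, ‖g y‖ = 1)
    (hper : Function.Periodic g (2 * π)) {H : ℝ} (hH0 : 0 < H) (hH1 : H ≤ 1)
    (hH : ∀ h ∈ Icc 0 H, (2 * π)⁻¹ * ∫ y in (-π)..π, ‖g (y + h) - g y‖ ^ 2 ≤ 1) :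
    Summable (fun n : ℤ => (1 + (n : ℝ) ^ 2) ^ (-(1 / 2) : ℝ) * ‖fourierCoefT g n‖ ^ 2) ∧
    H / 4 ≤ ∑' n : ℤ, (1 + (n : ℝ) ^ 2) ^ (-(1 / 2) : ℝ) * ‖fourierCoefT g n‖ ^ 2 := by
  have hs : Summable (fun n : ℤ => ‖fourierCoefT g n‖ ^ 2) :=
    (hasSum_sq_fourierCoefT hg (fun y => (h1 y).le)).summable
  have hsw : Summable (fun n : ℤ => (1 + (n : ℝ) ^ 2) ^ (-(1 / 2) : ℝ) * ‖fourierCoefT g n‖ ^ 2) := by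
    refine Summable.of_nonneg_of_le (fun n => by positivity) (fun n => ?_) hs
    refine mul_le_of_le_one_left (by positivity) ?_
    exact rpow_le_one_of_one_le_of_nonpos (by nlinarith [sq_nonneg (n : ℝ)]) (by norm_num)
  refine ⟨hsw, ?_⟩
  let f : ℤ → C(ℝ, ℝ) := fun n =>
    ⟨fun h => ‖fourierCoefT g n‖ ^ 2 * Real.cos (n * h), by fun_prop⟩
  have hfb : ∀ n h, ‖f n h‖ ≤ ‖fourierCoefT g n‖ ^ 2 := fun n h => by
    simp only [f, ContinuousMap.coe_mk, norm_mul, norm_pow, norm_norm]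
    exact mul_le_of_le_one_right (by positivity) (Real.abs_cos_le_one _)
  have hI := intervalIntegral.hasSum_intervalIntegral_of_summable_norm (a := 0) (b := H) (f := f)
    (Summable.of_nonneg_of_le (fun n => norm_nonneg _)
      (fun n => (ContinuousMap.norm_le _ (by positivity)).2 fun x => hfb n x) hs)
  have hcont : Continuous (fun h => ∑' n, f n h) :=
    continuous_tsum (fun n => (f n).continuous) hs hfb
  have hlow : H * (1 / 2) ≤ ∫ h in (0:ℝ)..H, ∑' n, f n h := by
    have hc : ∫ _ in (0:ℝ)..H, (1 / 2 : ℝ) = H * (1 / 2) := by simp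
    rw [← hc]
    refine intervalIntegral.integral_mono_on hH0.le (by simp) (hcont.intervalIntegrable _ _) ?_
    intro h hh
    have := (hasSum_sq_fourierCoefT_mul_cos hg h1 hper h).tsum_eq
    simp only [f, ContinuousMap.coe_mk]
    rw [this]
    linarith [hH h hh]
  have hup : ∫ h in (0:ℝ)..H, ∑' n, f n h
      ≤ 2 * ∑' n : ℤ, (1 + (n : ℝ) ^ 2) ^ (-(1 / 2) : ℝ) * ‖fourierCoefT g n‖ ^ 2 := by
    rw [← hI.tsum_eq, ← tsum_mul_left]
    refine hI.summable.tsum_le_tsum (fun n => ?_) (hsw.mul_left 2)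
    simp only [f, ContinuousMap.coe_mk]
    rw [intervalIntegral.integral_const_mul]
    calc _ ≤ ‖fourierCoefT g n‖ ^ 2 * (2 * (1 + (n : ℝ) ^ 2) ^ (-(1 / 2) : ℝ)) := by
          gcongr; exact integral_cos_int_mul_le hH1 n
      _ = _ := by ring
  linarith

lemma fourierCoefT_one (n : ℤ) : fourierCoefT (fun _ => 1) n = if n = 0 then 1 else 0 := by
  unfold fourierCoefT
  have hpi : (π : ℂ) ≠ 0 := by exact_mod_cast pi_ne_zero
  split_ifs with hn
  · subst hn
    simp
    field_simp
    norm_num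
  · have hc : -(Complex.I * n) ≠ 0 := by simp [hn]
    have := integral_exp_mul_complex (a := -π) (b := π) hc
    simp only [neg_mul, one_mul] at this ⊢
    rw [this]
    have h2 : Complex.exp (-(Complex.I * n * (π : ℝ)))
        = Complex.exp (-(Complex.I * n * ((-π : ℝ) : ℂ))) := by
      rw [Complex.exp_eq_exp_iff_exists_int]
      exact ⟨-n, by push_cast; ring⟩
    rw [h2]; simp

lemma sobolevNorm_one (s : ℝ) : sobolevNorm s (fun _ => 1) = 1 := by
  unfold sobolevNorm
  rw [tsum_eq_single 0]
  · simp [fourierCoefT_one]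
  · intro n hn
    simp [fourierCoefT_one, hn]

lemma sobolevNorm_eq_ofReal {s : ℝ} {g : ℝ → ℂ}
    (hs : Summable (fun n : ℤ => (1 + (n : ℝ) ^ 2) ^ s * ‖fourierCoefT g n‖ ^ 2)) :
    sobolevNorm s g
      = ENNReal.ofReal (Real.sqrt (∑' n : ℤ, (1 + (n : ℝ) ^ 2) ^ s * ‖fourierCoefT g n‖ ^ 2)) := by
  unfold sobolevNorm
  rw [Real.sqrt_eq_rpow, ← ENNReal.ofReal_rpow_of_nonneg (tsum_nonneg fun n => by positivity)
    (by norm_num), ENNReal.ofReal_tsum_of_nonneg (fun n => by positivity) hs]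
  congr 2
  ext n
  rw [ENNReal.ofReal_mul (by positivity), ENNReal.ofReal_pow (norm_nonneg _), ofReal_norm]
  rfl

lemma norm_exp_I_mul_ofReal_sub_le (a b : ℝ) :
    ‖Complex.exp (Complex.I * a) - Complex.exp (Complex.I * b)‖ ≤ |a - b| := by
  have : Complex.exp (Complex.I * a) - Complex.exp (Complex.I * b)
      = Complex.exp (Complex.I * b) * (Complex.exp (Complex.I * (a - b : ℝ)) - 1) := by
    rw [mul_sub, ← Complex.exp_add]; push_cast; ring_nf
  rw [this, norm_mul, Complex.norm_exp_I_mul_ofReal, one_mul]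
  exact Real.norm_exp_I_mul_ofReal_sub_one_le

lemma lintegral_abs_add_sub_le {α : ℝ} {u : ℝ → ℝ} (hu : besovSeminorm α u < ⊤) {h : ℝ}
    (hh : h ∈ Ioc 0 π) :
    ∫⁻ y in Ioc (-π) π, ENNReal.ofReal |u (y + h) - u y|
      ≤ ENNReal.ofReal ((besovSeminorm α u).toReal * h ^ α) := by
  have h0 : 0 < h ^ α := rpow_pos_of_pos hh.1 _
  have key : ENNReal.ofReal (h ^ (-α)) * ∫⁻ y in Ioc (-π) π, ENNReal.ofReal |u (y + h) - u y|
      ≤ besovSeminorm α u :=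
    le_iSup₂ (f := fun h (_ : h ∈ Ioc (0:ℝ) π) => ENNReal.ofReal (h ^ (-α)) *
      ∫⁻ y in Ioc (-π) π, ENNReal.ofReal |u (y + h) - u y|) h hh
  calc _ = ENNReal.ofReal (h ^ α) * (ENNReal.ofReal (h ^ (-α)) *
        ∫⁻ y in Ioc (-π) π, ENNReal.ofReal |u (y + h) - u y|) := by
        rw [← mul_assoc, ← ENNReal.ofReal_mul h0.le, ← rpow_add hh.1]; simp
    _ ≤ ENNReal.ofReal (h ^ α) * besovSeminorm α u := by gcongr
    _ = _ := by
        rw [mul_comm, ENNReal.ofReal_mul ENNReal.toReal_nonneg, ENNReal.ofReal_toReal hu.ne]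

/-- The squared `L²` modulus of continuity of `e^{-itu}` is controlled by the `L¹` modulus of
continuity of `u`. -/
lemma integral_sq_norm_exp_add_sub_le {α : ℝ} {u : ℝ → ℝ} (hum : Measurable u)
    (hu : besovSeminorm α u < ⊤) {t : ℝ} (ht : 0 ≤ t) {h : ℝ} (hh : h ∈ Ioc 0 π) :
    ∫ y in (-π)..π, ‖Complex.exp (Complex.I * (-(t * u (y + h)) : ℝ))
        - Complex.exp (Complex.I * (-(t * u y) : ℝ))‖ ^ 2
      ≤ 2 * t * ((besovSeminorm α u).toReal * h ^ α) := by
  have hnn : 0 ≤ (besovSeminorm α u).toReal * h ^ α :=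
    mul_nonneg ENNReal.toReal_nonneg (rpow_nonneg hh.1.le _)
  have hm : Measurable fun y => u (y + h) := hum.comp (measurable_id.add_const h)
  rw [intervalIntegral.integral_of_le (by linarith [pi_pos]),
    integral_eq_lintegral_of_nonneg_ae (ae_of_all _ fun y => by positivity)
      (by fun_prop)]
  refine ENNReal.toReal_le_of_le_ofReal (by positivity) ?_
  calc _ ≤ ∫⁻ y in Ioc (-π) π, ENNReal.ofReal (2 * t) * ENNReal.ofReal |u (y + h) - u y| := by
        refine lintegral_mono fun y => ?_
        rw [← ENNReal.ofReal_mul (by positivity)]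
        refine ENNReal.ofReal_le_ofReal ?_
        have e1 := norm_exp_I_mul_ofReal_sub_le (-(t * u (y + h))) (-(t * u y))
        have e2 : |-(t * u (y + h)) - -(t * u y)| = t * |u (y + h) - u y| := by
          rw [show -(t * u (y + h)) - -(t * u y) = -(t * (u (y + h) - u y)) by ring, abs_neg,
            abs_mul, abs_of_nonneg ht]
        have e3 := norm_sub_le (Complex.exp (Complex.I * (-(t * u (y + h)) : ℝ)))
          (Complex.exp (Complex.I * (-(t * u y) : ℝ)))
        rw [Complex.norm_exp_I_mul_ofReal, Complex.norm_exp_I_mul_ofReal] at e3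
        rw [e2] at e1
        rw [sq, mul_assoc 2]
        exact mul_le_mul (by linarith) e1 (norm_nonneg _) (by norm_num)
    _ = ENNReal.ofReal (2 * t) * ∫⁻ y in Ioc (-π) π, ENNReal.ofReal |u (y + h) - u y| :=
        lintegral_const_mul _ (by fun_prop)
    _ ≤ ENNReal.ofReal (2 * t) * ENNReal.ofReal ((besovSeminorm α u).toReal * h ^ α) := by
        gcongr; exact lintegral_abs_add_sub_le hu hh
    _ = _ := by rw [← ENNReal.ofReal_mul (by positivity)]

/-- Corollary 3.2: if `u ∈ B^α_{1,∞}(𝕋)` is mixing on the scale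
`H^{1/2}(𝕋;ℂ)` with rate `r` then `r(t) ≤ C t^{1/(2α)}` for all `t ≥ 1`. -/
theorem mixing_rate_upper_bound
    (α : ℝ) (hα : α ∈ Set.Ioo (0:ℝ) 1)
    (u : ℝ → ℝ) (hu_meas : Measurable u) (hu_per : Function.Periodic u (2 * π))
    (hu : besovNorm α u < ⊤)
    (r : ℝ → ℝ) (hr_nonneg : ∀ x, 0 ≤ x → 0 ≤ r x)
    (hr_mono : MonotoneOn r (Set.Ici 0)) (hr_cont : ContinuousOn r (Set.Ici 0))
    (hmix : MixingHalf u r) :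
    ∃ C > (0:ℝ), ∀ t : ℝ, 1 ≤ t → r t ≤ C * t ^ (1 / (2 * α)) := by
  obtain ⟨hα0, -⟩ := hα
  have hsemi : besovSeminorm α u < ⊤ := lt_of_le_of_lt le_add_self hu
  obtain ⟨C, hC, hmix⟩ := hmix
  set M := (besovSeminorm α u).toReal with hM
  have hM0 : 0 ≤ M := ENNReal.toReal_nonneg
  set K := max 1 M with hK
  have hK1 : 1 ≤ K := le_max_left _ _
  have hK0 : 0 < K := by linarith
  refine ⟨2 * C * K ^ (1 / (2 * α)), by positivity, fun t ht => ?_⟩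
  have ht0 : 0 < t := by linarith
  set H := (K * t) ^ (-(1 / α)) with hHdef
  have hKt0 : 0 < K * t := by positivity
  have hH0 : 0 < H := rpow_pos_of_pos hKt0 _
  have hH1 : H ≤ 1 := rpow_le_one_of_one_le_of_nonpos (one_le_mul_of_one_le_of_one_le hK1 ht)
    (by simp only [Left.neg_nonpos_iff]; positivity)
  have hHα : H ^ α = (K * t)⁻¹ := by
    rw [hHdef, ← rpow_mul hKt0.le, neg_mul, one_div_mul_cancel hα0.ne', rpow_neg_one]
  set g : ℝ → ℂ := fun y => Complex.exp (Complex.I * (-(t * u y) : ℝ)) with hg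
  have hgm : Measurable g := by fun_prop
  have hg1 : ∀ y, ‖g y‖ = 1 := fun y => Complex.norm_exp_I_mul_ofReal _
  have hgp : Function.Periodic g (2 * π) := fun y => by simp only [hg, hu_per y]
  obtain ⟨hsum, hlow⟩ := le_tsum_sq_fourierCoefT_mul_rpow hgm hg1 hgp hH0 hH1 fun h hh => by
    rcases hh.1.eq_or_lt with rfl | hpos
    · simp
    have hle := integral_sq_norm_exp_add_sub_le hu_meas hsemi ht0.le
      (h := h) ⟨hpos, by linarith [hh.2, pi_gt_three]⟩
    have hb : M * h ^ α ≤ t⁻¹ := by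
      calc M * h ^ α ≤ K * H ^ α := by
            gcongr
            · exact le_max_right _ _
            · exact hh.2
        _ = t⁻¹ := by rw [hHα]; field_simp
    have h2 : 2 * t * (M * h ^ α) ≤ 2 := by
      calc _ ≤ 2 * t * t⁻¹ := by gcongr
        _ = 2 := by field_simp
    rw [inv_mul_le_iff₀ (by positivity)]
    linarith [pi_gt_three]
  have hmx := hmix 1 one_ne_zero t ht (fun _ => 1) measurable_const (fun _ => rfl)
    (by rw [sobolevNorm_one]; exact ENNReal.one_lt_top)
  have hfun : (fun y => Complex.exp (-(Complex.I * t * (1 : ℤ) * u y)) * (1 : ℂ)) = g := by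
    ext y
    simp only [hg, mul_one]
    congr 1; push_cast; ring
  rw [hfun, sobolevNorm_one, sobolevNorm_eq_ofReal hsum, Int.cast_one, abs_one, mul_one,
    mul_one] at hmx
  have hbound : C / Real.sqrt (H / 4) = 2 * C * K ^ (1 / (2 * α)) * t ^ (1 / (2 * α)) := by
    have h4 : Real.sqrt (H / 4) = (K * t) ^ (-(1 / (2 * α))) / 2 := by
      rw [Real.sqrt_div hH0.le, show (4 : ℝ) = 2 ^ 2 by norm_num, Real.sqrt_sq (by norm_num),
        Real.sqrt_eq_rpow, hHdef, ← rpow_mul hKt0.le]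
      congr 2
      field_simp
    rw [h4, rpow_neg hKt0.le, mul_rpow hK0.le ht0.le]
    field_simp
  rw [← hbound]
  rcases (hr_nonneg t ht0.le).eq_or_lt with h0 | hrpos
  · rw [← h0]; positivity
  rw [← ENNReal.ofReal_div_of_pos hrpos, ENNReal.ofReal_le_ofReal_iff (by positivity),
    le_div_iff₀ hrpos] at hmx
  rw [le_div_iff₀ (Real.sqrt_pos.2 (by positivity)), mul_comm]
  exact (mul_le_mul_of_nonneg_right (Real.sqrt_le_sqrt hlow) hrpos.le).trans hmx
end
end

section
/- Let α ∈ (0,1), ε > 0 and set β := α + ε(1+α). For u ∈ L¹(0,π), extended by zero outside [0,π], let ψ(y) := ∫₀^y u(z) dz, let G_α(ȳ,δ) := ∫_{ȳ}^{ȳ+δ} |Δ²_δ ψ(y)|^{−1/(1+α)} dy, and define K_{α,ε}(u) := sup_{n ∈ ℕ} sup_{1 ≤ k ≤ 2ⁿ−1} 2^{−nε} G_α(π k 2^{−n}, π 2^{−n−1}) ∈ [0,+∞]. Then there exists a constant C = C(α,ε) > 0 such that Γ_β(u) ≥ C · K_{α,ε}(u)^{−(1+α)}, with the convention (+∞)^{−(1+α)}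 := 0. -/
open MeasureTheory Real Set
open scoped ENNReal NNReal

noncomputable section

/-- Second difference operator `Δ²_δ f(y) = f(y+2δ) − 2f(y+δ) + f(y)`. -/
def secondDiff (δ : ℝ) (f : ℝ → ℝ) (y : ℝ) : ℝ := f (y + 2 * δ) - 2 * f (y + δ) + f y

/-- `G_α(ȳ,δ) = ∫_{ȳ}^{ȳ+δ} |Δ²_δ ψ(y)|^{−1/(1+α)} dy`, with `0^{−1/(1+α)} = +∞`. -/
def Gfun (α : ℝ) (ψ : ℝ → ℝ) (ybar δ : ℝ) : ℝ≥0∞ :=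
  ∫⁻ y in Set.Ioc ybar (ybar + δ),
    (ENNReal.ofReal |secondDiff δ ψ y|) ^ (-(1 / (1 + α)))

/-- ψ(y) = ∫₀^y u(z) dz for `u ∈ L¹(0,π)` extended by zero outside `[0,π]`. -/
def primOfI (u : ℝ → ℝ) (y : ℝ) : ℝ :=
  ∫ z in (0:ℝ)..y, Set.indicator (Set.Icc 0 π) u z

/-- Wei's quantity `Γ_β(u)` for `u ∈ L¹(0,π)` (extended by zero outside `[0,π]`). -/
def GammaI (β : ℝ) (u : ℝ → ℝ) : ℝ :=
  Real.sqrt (sInf {v : ℝ | ∃ δ ∈ Set.Ioo (0:ℝ) 1, ∃ ybar ∈ Set.Icc (0:ℝ) (π - δ),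
    ∃ c₁ c₂ : ℝ,
    v = δ ^ (-(2 * β + 3)) * ∫ y in ybar..(ybar + δ), (primOfI u y - c₁ - c₂ * y) ^ 2})

/-- The quantity `K_{α,ε}(u) = sup_{n ∈ ℕ, 1 ≤ k ≤ 2ⁿ−1} 2^{−nε} G_α(πk2^{−n}, π2^{−n−1})`. -/
def Kconst (α ε : ℝ) (u : ℝ → ℝ) : ℝ≥0∞ :=
  ⨆ n : ℕ, ⨆ k ∈ Set.Icc 1 (2 ^ n - 1),
    ENNReal.ofReal ((2:ℝ) ^ (-(n : ℝ) * ε)) *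
      Gfun α (primOfI u) (π * (k : ℕ) / 2 ^ n) (π / 2 ^ (n + 1))

/-- Second differences annihilate affine functions. -/
lemma secondDiff_sub_affine (δ c₁ c₂ : ℝ) (f : ℝ → ℝ) (y : ℝ) :
    secondDiff δ (fun z => f z - c₁ - c₂ * z) y = secondDiff δ f y := by
  simp only [secondDiff]; ring

lemma continuous_secondDiff {f : ℝ → ℝ} (hf : Continuous f) (δ : ℝ) :
    Continuous (secondDiff δ f) := by
  unfold secondDiff; fun_prop

/-- The `L²` norm of the second difference on `[a, a + h]` is controlled by the `L²` norm of
the function on any interval containing `[a, a + 3 h]`. -/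
lemma integral_secondDiff_sq_le {f : ℝ → ℝ} (hf : Continuous f) {a h s t : ℝ} (hh : 0 ≤ h)
    (hs : s ≤ a) (ht : a + 3 * h ≤ t) :
    ∫ y in a..(a + h), secondDiff h f y ^ 2 ≤ 6 * ∫ y in s..t, f y ^ 2 := by
  have hi : ∀ x y : ℝ, IntervalIntegrable (fun z => f z ^ 2) volume x y := fun x y =>
    (by fun_prop : Continuous fun z => f z ^ 2).intervalIntegrable _ _
  have h1 : ∫ y in a..(a + h), secondDiff h f y ^ 2 ≤
      ∫ y in a..(a + h), 6 * (f (y + 2 * h) ^ 2 + f (y + h) ^ 2 + f y ^ 2) := by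
    apply intervalIntegral.integral_mono_on (by linarith)
    · exact ((continuous_secondDiff hf h).pow 2).intervalIntegrable _ _
    · exact (by fun_prop : Continuous fun y =>
        6 * (f (y + 2 * h) ^ 2 + f (y + h) ^ 2 + f y ^ 2)).intervalIntegrable _ _
    · intro y _
      simp only [secondDiff]
      nlinarith [sq_nonneg (2 * f (y + 2 * h) + f (y + h)), sq_nonneg (2 * f y + f (y + h)),
        sq_nonneg (f (y + 2 * h) - f y)]
  have h2 : ∫ y in a..(a + h), 6 * (f (y + 2 * h) ^ 2 + f (y + h) ^ 2 + f y ^ 2) =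
      6 * ∫ y in a..(a + 3 * h), f y ^ 2 := by
    rw [intervalIntegral.integral_const_mul, intervalIntegral.integral_add,
      intervalIntegral.integral_add,
      intervalIntegral.integral_comp_add_right (fun z => f z ^ 2),
      intervalIntegral.integral_comp_add_right (fun z => f z ^ 2),
      ← intervalIntegral.integral_add_adjacent_intervals (hi a (a + h)) (hi _ (a + 3 * h)),
      ← intervalIntegral.integral_add_adjacent_intervals (hi (a + h) (a + 2 * h))
        (hi _ (a + 3 * h))]
    · ring_nf
    all_goals
      apply Continuous.intervalIntegrable
      fun_prop
  have h3 : ∫ y in a..(a + 3 * h), f y ^ 2 ≤ ∫ y in s..t, f y ^ 2 :=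
    intervalIntegral.integral_mono_interval hs (by linarith) ht
      (Filter.Eventually.of_forall fun y => sq_nonneg _) (hi _ _)
  linarith

/-- A quantitative lower bound for the integral of a negative power of `|g|` in terms of an
upper bound for the `L²` norm of `g`. -/
lemma ofReal_le_lintegral_rpow_neg {g : ℝ → ℝ} (hg : Continuous g) {a h M q : ℝ} (hh : 0 ≤ h)
    (hM : 0 < M) (hq : 0 ≤ q) (hI : ∫ y in a..(a + h), g y ^ 2 ≤ M ^ 2 * (h / 2)) :
    ENNReal.ofReal (M ^ (-q) * (h / 2)) ≤
      ∫⁻ y in Set.Ioc a (a + h), (ENNReal.ofReal |g y|) ^ (-q) := by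
  have hah : a ≤ a + h := by linarith
  set F : ℝ → ℝ := fun y => M ^ (-q) * (1 - g y ^ 2 / M ^ 2) with hF
  have hFc : Continuous F := by fun_prop
  have hFi : IntegrableOn F (Set.Ioc a (a + h)) :=
    (intervalIntegrable_iff_integrableOn_Ioc_of_le hah).1 (hFc.intervalIntegrable _ _)
  have hMq : 0 < M ^ (-q) := Real.rpow_pos_of_pos hM _
  have h1 : M ^ (-q) * (h / 2) ≤ ∫ y in Set.Ioc a (a + h), F y := by
    rw [← intervalIntegral.integral_of_le hah, hF, intervalIntegral.integral_const_mul,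
      intervalIntegral.integral_sub (by simp)
        ((by fun_prop : Continuous fun y => g y ^ 2 / M ^ 2).intervalIntegrable _ _),
      intervalIntegral.integral_div]
    gcongr
    have : (∫ y in a..(a + h), g y ^ 2) / M ^ 2 ≤ h / 2 := by
      rw [div_le_iff₀ (by positivity)]; linarith
    simp only [intervalIntegral.integral_const, smul_eq_mul]
    linarith
  have h2 : ∫ y in Set.Ioc a (a + h), F y ≤ ∫ y in Set.Ioc a (a + h), max (F y) 0 :=
    integral_mono hFi hFi.pos_part fun y => le_max_left _ _
  refine (ENNReal.ofReal_le_ofReal (h1.trans h2)).trans ?_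
  rw [ofReal_integral_eq_lintegral_ofReal hFi.pos_part
    (Filter.Eventually.of_forall fun y => le_max_right _ _)]
  refine lintegral_mono fun y => ?_
  by_cases hy : |g y| ≤ M
  · calc ENNReal.ofReal (max (F y) 0) ≤ ENNReal.ofReal (M ^ (-q)) := by
          apply ENNReal.ofReal_le_ofReal
          refine max_le ?_ hMq.le
          have : 0 ≤ g y ^ 2 / M ^ 2 := by positivity
          simp only [hF]
          nlinarith
      _ = ENNReal.ofReal M ^ (-q) := (ENNReal.ofReal_rpow_of_pos hM).symm
      _ ≤ ENNReal.ofReal |g y| ^ (-q) := by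
          rw [ENNReal.rpow_neg, ENNReal.rpow_neg, ENNReal.inv_le_inv]
          exact ENNReal.rpow_le_rpow (ENNReal.ofReal_le_ofReal hy) hq
  · have : F y ≤ 0 := by
      refine mul_nonpos_of_nonneg_of_nonpos hMq.le ?_
      rw [sub_nonpos, one_le_div (by positivity), ← sq_abs (g y)]
      exact pow_le_pow_left₀ hM.le (not_le.1 hy).le 2
    simp [max_eq_right this]

lemma continuous_primOfI {u : ℝ → ℝ} (hu : IntegrableOn u (Set.Icc 0 π)) :
    Continuous (primOfI u) := by
  have : Integrable (Set.indicator (Set.Icc 0 π) u) :=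
    (integrable_indicator_iff measurableSet_Icc).2 hu
  exact intervalIntegral.continuous_primitive (fun _ _ => this.intervalIntegrable) 0

/-- Every interval `[s, s + δ] ⊆ [0, π]` contains three consecutive dyadic half cells
starting at an interior dyadic point, of length comparable to `δ`. -/
lemma exists_dyadic_cell {s δ : ℝ} (hδ : δ ∈ Set.Ioo (0 : ℝ) 1) (hs : s ∈ Set.Icc 0 (π - δ)) :
    ∃ n k : ℕ, k ∈ Set.Icc 1 (2 ^ n - 1) ∧ s ≤ π * k / 2 ^ n ∧
      π * k / 2 ^ n + 3 * (π / 2 ^ (n + 1)) ≤ s + δ ∧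
      δ / 10 ≤ π / 2 ^ (n + 1) ∧ (2 : ℝ) ^ n ≤ 5 * π / δ := by
  obtain ⟨hδ0, hδ1⟩ := hδ
  obtain ⟨hs0, hs1⟩ := hs
  have hπ := Real.pi_gt_three
  obtain ⟨m, hm1, hm2⟩ := exists_nat_pow_near (x := 5 / 2 * π / δ) (y := 2)
    (by rw [one_le_div hδ0]; linarith) one_lt_two
  rw [le_div_iff₀ hδ0] at hm1
  rw [div_lt_iff₀ hδ0] at hm2
  set d : ℝ := π / 2 ^ (m + 1) with hd
  have hd0 : 0 < d := by positivity
  have hdπ : 2 ^ (m + 1) * d = π := by rw [hd]; field_simp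
  have hdδ : 5 / 2 * d < δ := by
    by_contra! hc
    have := mul_le_mul_of_nonneg_left hc (by positivity : (0 : ℝ) ≤ 2 ^ (m + 1))
    linarith
  have hδd : δ ≤ 5 * d := by
    by_contra! hc
    have := mul_lt_mul_of_pos_left hc (by positivity : (0 : ℝ) < 2 ^ (m + 1))
    rw [pow_succ] at this hdπ
    linarith
  have hk1 : s / d < (⌊s / d⌋₊ : ℝ) + 1 := Nat.lt_floor_add_one _
  have hk2 : (⌊s / d⌋₊ : ℝ) ≤ s / d := Nat.floor_le (by positivity)
  rw [div_lt_iff₀ hd0] at hk1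
  rw [le_div_iff₀ hd0] at hk2
  have ha : π * ((⌊s / d⌋₊ + 1 : ℕ) : ℝ) / 2 ^ (m + 1) = ((⌊s / d⌋₊ : ℝ) + 1) * d := by
    rw [hd]; push_cast; ring
  have hh : π / 2 ^ (m + 1 + 1) = d / 2 := by rw [hd, pow_succ _ (m + 1)]; field_simp
  refine ⟨m + 1, ⌊s / d⌋₊ + 1, ⟨by omega, ?_⟩, ?_, ?_, ?_, ?_⟩
  · have : ((⌊s / d⌋₊ + 1 : ℕ) : ℝ) < ((2 ^ (m + 1) : ℕ) : ℝ) := by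
      push_cast
      refine lt_of_mul_lt_mul_right ?_ hd0.le
      linarith
    have := Nat.cast_lt.1 this
    omega
  · rw [ha]; linarith
  · rw [ha, hh]; linarith
  · rw [hh]; linarith
  · rw [le_div_iff₀ hδ0, pow_succ]; linarith

/-- The comparison of `Kconst` with one normalized `L²` distance to affine functions. -/
lemma Kconst_rpow_neg_le {α ε : ℝ} (hα : 0 < α) (hε : 0 < ε) {u : ℝ → ℝ}
    (hu : IntegrableOn u (Set.Icc 0 π)) {s δ c₁ c₂ w : ℝ} (hδ : δ ∈ Set.Ioo (0 : ℝ) 1)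
    (hs : s ∈ Set.Icc 0 (π - δ))
    (hw : δ ^ (-(2 * (α + ε * (1 + α)) + 3)) *
      ∫ y in s..(s + δ), (primOfI u y - c₁ - c₂ * y) ^ 2 < w) :
    Kconst α ε u ^ (-(1 + α)) ≤
      ENNReal.ofReal ((5 * π) ^ (ε * (1 + α)) * 20 ^ (1 + α) * √(120 * w)) := by
  obtain ⟨n, k, hk, hsa, hat, hh, hn⟩ := exists_dyadic_cell hδ hs
  obtain ⟨hδ0, hδ1⟩ := hδ
  set β := α + ε * (1 + α) with hβ
  set a : ℝ := π * k / 2 ^ n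
  set h : ℝ := π / 2 ^ (n + 1)
  have hh0 : 0 < h := by positivity
  have hψ := continuous_primOfI hu
  set f : ℝ → ℝ := fun z => primOfI u z - c₁ - c₂ * z with hf
  have hfc : Continuous f := by fun_prop
  have hI0 : 0 ≤ ∫ y in s..(s + δ), f y ^ 2 :=
    intervalIntegral.integral_nonneg (by linarith) fun _ _ => sq_nonneg _
  have hw0 : 0 < w := lt_of_le_of_lt (by positivity) hw
  set M : ℝ := √(120 * w) * δ ^ (β + 1) with hM
  have hM0 : 0 < M := by positivity
  have hM2 : M ^ 2 = 120 * w * δ ^ (2 * β + 2) := by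
    rw [hM, mul_pow, Real.sq_sqrt (by positivity), ← Real.rpow_mul_natCast hδ0.le]
    congr 2; push_cast; ring
  have hIw : ∫ y in s..(s + δ), f y ^ 2 < w * (δ ^ (2 * β + 2) * δ) := by
    rw [Real.rpow_neg hδ0.le, inv_mul_lt_iff₀ (by positivity)] at hw
    rwa [← Real.rpow_add_one hδ0.ne', mul_comm,
      show 2 * β + 2 + 1 = 2 * β + 3 by ring]
  have hD : ∫ y in a..(a + h), secondDiff h (primOfI u) y ^ 2 ≤ M ^ 2 * (h / 2) := by
    have h1 := integral_secondDiff_sq_le hfc hh0.le hsa hat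
    simp only [hf, secondDiff_sub_affine] at h1
    have h2 : 120 * w * δ ^ (2 * β + 2) * (δ / 10 / 2) ≤ M ^ 2 * (h / 2) := by
      rw [hM2]; gcongr
    linarith
  have hG := ofReal_le_lintegral_rpow_neg (continuous_secondDiff hψ h) hh0.le hM0
    (q := 1 / (1 + α)) (by positivity) hD
  have hK : ENNReal.ofReal ((2 : ℝ) ^ (-(n : ℝ) * ε) * (M ^ (-(1 / (1 + α))) * (h / 2))) ≤
      Kconst α ε u := by
    rw [ENNReal.ofReal_mul (by positivity)]
    refine (mul_le_mul_right hG _).trans ?_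
    exact le_iSup_of_le n (le_iSup₂_of_le k hk le_rfl)
  calc Kconst α ε u ^ (-(1 + α))
      ≤ ENNReal.ofReal ((2 : ℝ) ^ (-(n : ℝ) * ε) * (M ^ (-(1 / (1 + α))) * (h / 2)))
          ^ (-(1 + α)) := by
        rw [ENNReal.rpow_neg, ENNReal.rpow_neg, ENNReal.inv_le_inv]
        exact ENNReal.rpow_le_rpow hK (by positivity)
    _ = ENNReal.ofReal (((2 : ℝ) ^ (-(n : ℝ) * ε) * (M ^ (-(1 / (1 + α))) * (h / 2)))
          ^ (-(1 + α))) := ENNReal.ofReal_rpow_of_pos (by positivity)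
    _ ≤ _ := by
        apply ENNReal.ofReal_le_ofReal
        have e1 : ((2 : ℝ) ^ (-(n : ℝ) * ε)) ^ (-(1 + α)) = ((2 : ℝ) ^ n) ^ (ε * (1 + α)) := by
          rw [← Real.rpow_mul two_pos.le, ← Real.rpow_natCast_mul two_pos.le]
          congr 1; ring
        have e2 : (M ^ (-(1 / (1 + α)))) ^ (-(1 + α)) = M := by
          rw [← Real.rpow_mul hM0.le]
          have : -(1 / (1 + α)) * -(1 + α) = 1 := by field_simp
          rw [this, Real.rpow_one]
        have e3 : (h / 2) ^ (-(1 + α)) ≤ (δ / 20) ^ (-(1 + α)) :=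
          Real.rpow_le_rpow_of_nonpos (by positivity) (by linarith) (by linarith)
        rw [Real.mul_rpow (by positivity) (by positivity),
          Real.mul_rpow (by positivity) (by positivity), e1, e2]
        calc ((2 : ℝ) ^ n) ^ (ε * (1 + α)) * (M * (h / 2) ^ (-(1 + α)))
            ≤ (5 * π / δ) ^ (ε * (1 + α)) * (M * (δ / 20) ^ (-(1 + α))) := by gcongr
          _ = (5 * π) ^ (ε * (1 + α)) * 20 ^ (1 + α) * √(120 * w) := by
              rw [Real.div_rpow (by positivity) hδ0.le, Real.rpow_neg (by positivity),
                Real.div_rpow hδ0.le (by norm_num), hM, hβ,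
                show α + ε * (1 + α) + 1 = ε * (1 + α) + (1 + α) by ring, Real.rpow_add hδ0]
              field_simp

/-- Lemma 4.9: for `α ∈ (0,1)`, `ε > 0` and `β = α + ε(1+α)`, there is
`C = C(α,ε) > 0` such that `Γ_β(u) ≥ C K_{α,ε}(u)^{−(1+α)}` for every `u ∈ L¹(0,π)`,
with the convention `(+∞)^{−(1+α)} = 0`. -/
theorem gamma_lower_bound_via_K
    (α ε : ℝ) (hα : α ∈ Set.Ioo (0:ℝ) 1) (hε : 0 < ε) :
    ∃ C > (0:ℝ), ∀ u : ℝ → ℝ, Measurable u → IntegrableOn u (Set.Icc 0 π) →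
      ENNReal.ofReal C * (Kconst α ε u) ^ (-(1 + α))
        ≤ ENNReal.ofReal (GammaI (α + ε * (1 + α)) u) := by
  set A : ℝ := (5 * π) ^ (ε * (1 + α)) * 20 ^ (1 + α) * √120 with hA
  have hA0 : 0 < A := by have := hα.1; positivity
  refine ⟨A⁻¹, by positivity, fun u _ hu => ?_⟩
  set S : Set ℝ := {v : ℝ | ∃ δ ∈ Set.Ioo (0:ℝ) 1, ∃ ybar ∈ Set.Icc (0:ℝ) (π - δ),
    ∃ c₁ c₂ : ℝ, v = δ ^ (-(2 * (α + ε * (1 + α)) + 3)) *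
      ∫ y in ybar..(ybar + δ), (primOfI u y - c₁ - c₂ * y) ^ 2} with hS
  have hne : S.Nonempty :=
    ⟨_, 1 / 2, by norm_num, 0, ⟨le_rfl, by linarith [Real.pi_gt_three]⟩, 0, 0, rfl⟩
  have key : ∀ w, sInf S < w →
      Kconst α ε u ^ (-(1 + α)) ≤ ENNReal.ofReal (A * √w) := by
    intro w hw
    obtain ⟨v, ⟨δ, hδ, s, hs, c₁, c₂, rfl⟩, hvw⟩ := exists_lt_of_csInf_lt hne hw
    have := Kconst_rpow_neg_le hα.1 hε hu hδ hs hvw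
    rwa [Real.sqrt_mul (by norm_num), ← mul_assoc] at this
  have hlim : Filter.Tendsto (fun w => ENNReal.ofReal (A * √w))
      (nhdsWithin (sInf S) (Set.Ioi (sInf S))) (nhds (ENNReal.ofReal (A * √(sInf S)))) :=
    ((ENNReal.continuous_ofReal.comp (by fun_prop : Continuous fun w => A * √w)).tendsto _).mono_left
      nhdsWithin_le_nhds
  have hle : Kconst α ε u ^ (-(1 + α)) ≤ ENNReal.ofReal (A * √(sInf S)) :=
    ge_of_tendsto hlim (Filter.eventually_of_mem self_mem_nhdsWithin key)
  calc ENNReal.ofReal A⁻¹ * Kconst α ε u ^ (-(1 + α))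
      ≤ ENNReal.ofReal A⁻¹ * ENNReal.ofReal (A * √(sInf S)) := by gcongr
    _ = ENNReal.ofReal (GammaI (α + ε * (1 + α)) u) := by
        rw [← ENNReal.ofReal_mul (by positivity), inv_mul_cancel_left₀ hA0.ne', GammaI]
end
end
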